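/- arXiv:1402.2900 — 2 statements merged into one kernel-verified Lean document; each statement's English description precedes it below -/
import Mathlib

section
/- (Neo-classical inequality, as used in the paper) For real p ≥ 1, integer k ≥ 0, and nonnegative reals x₁,…,x_m: Σ_{s₁+⋯+s_m = k, s_i ≥ 0 integers} Π_{i=1}^m x_i^{s_i/p} / Γ(s_i/p + 1) ≤ p^{2m−2} · (x₁ + ⋯ + x_m)^{k/p} / Γ(k/p + 1). -/
/-!
Statement 7 (neo-classical inequality, Hara–Hino): for real `p ≥ 1`,
integer `k ≥ 0`, and nonnegative reals `x₁,…,x_m` (`m ≥ 1`):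
`∑_{s₁+⋯+s_m = k} ∏ᵢ xᵢ^{sᵢ/p} / (sᵢ/p)! ≤ p^{2m−2} (x₁+⋯+x_m)^{k/p} / (k/p)!`,
where `(s/p)! = Γ(s/p + 1)`.
-/

open scoped BigOperators

namespace NeoClassical

open MeasureTheory Set
open scoped ENNReal

/-- The function `t ↦ t ^ b / Γ(b + 1)` on `[0, ∞)`, extended by zero. -/
noncomputable def fracPow (b t : ℝ) : ℝ≥0∞ :=
  if 0 ≤ t then ENNReal.ofReal (t ^ b / Real.Gamma (b + 1)) else 0

/-- The kernel `t ↦ t ^ (a - 1) / Γ(a)` of the fractional integral of order `a`. -/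
noncomputable def rlKernel (a t : ℝ) : ℝ≥0∞ :=
  if 0 < t then ENNReal.ofReal (t ^ (a - 1) / Real.Gamma a) else 0

/-- Minus the derivative of `rlKernel a`. -/
noncomputable def rlKernelSlope (a t : ℝ) : ℝ≥0∞ :=
  if 0 < t then ENNReal.ofReal ((1 - a) * t ^ (a - 2) / Real.Gamma a) else 0

/-- The sum on the left-hand side of the two-variable neo-classical inequality. -/
noncomputable def binomSum (a : ℝ) (n : ℕ) (x y : ℝ) : ℝ≥0∞ :=
  ∑ ij ∈ Finset.HasAntidiagonal.antidiagonal n, fracPow (a * ij.1) x * fracPow (a * ij.2) y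

@[fun_prop]
lemma measurable_fracPow (b : ℝ) : Measurable (fracPow b) :=
  Measurable.ite measurableSet_Ici (by fun_prop) measurable_const

@[fun_prop]
lemma measurable_rlKernel (a : ℝ) : Measurable (rlKernel a) :=
  Measurable.ite measurableSet_Ioi (by fun_prop) measurable_const

@[fun_prop]
lemma measurable_rlKernelSlope (a : ℝ) : Measurable (rlKernelSlope a) :=
  Measurable.ite measurableSet_Ioi (by fun_prop) measurable_const

@[fun_prop]
lemma measurable_binomSum_comp {Z : Type*} [MeasurableSpace Z] (a : ℝ) (n : ℕ) {f g : Z → ℝ}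
    (hf : Measurable f) (hg : Measurable g) : Measurable fun z => binomSum a n (f z) (g z) := by
  unfold binomSum
  fun_prop

lemma fracPow_of_neg {b t : ℝ} (ht : t < 0) : fracPow b t = 0 := if_neg ht.not_ge

lemma fracPow_zero_left {t : ℝ} (ht : 0 ≤ t) : fracPow 0 t = 1 := by
  simp [fracPow, ht]

lemma rlKernel_of_nonpos {a t : ℝ} (ht : t ≤ 0) : rlKernel a t = 0 := if_neg ht.not_gt

lemma binomSum_of_neg_left {a : ℝ} {n : ℕ} {x y : ℝ} (hx : x < 0) : binomSum a n x y = 0 := by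
  simp [binomSum, fracPow_of_neg hx]

lemma binomSum_of_neg_right {a : ℝ} {n : ℕ} {x y : ℝ} (hy : y < 0) : binomSum a n x y = 0 := by
  simp [binomSum, fracPow_of_neg hy]

lemma lintegral_eq_mul_lintegral_comp_mul {g : ℝ → ℝ≥0∞} (hg : Measurable g) {t : ℝ}
    (ht : 0 < t) : ∫⁻ v, g v = ENNReal.ofReal t * ∫⁻ r, g (t * r) := by
  conv_lhs => rw [← Real.smul_map_volume_mul_left ht.ne']
  rw [lintegral_smul_measure, lintegral_map hg (by fun_prop), abs_of_pos ht, smul_eq_mul]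

lemma lintegral_rlKernel_mul_fracPow {a b : ℝ} (ha : 0 < a) (hb : 0 ≤ b) (t : ℝ) :
    ∫⁻ v, rlKernel a v * fracPow b (t - v) = fracPow (a + b) t := by
  rcases le_or_gt t 0 with ht | ht
  · have h0 : ∀ v, rlKernel a v * fracPow b (t - v) = 0 := fun v => by
      rcases le_or_gt v 0 with hv | hv
      · rw [rlKernel_of_nonpos hv, zero_mul]
      · rw [fracPow_of_neg (by linarith), mul_zero]
    simp only [h0, lintegral_zero]
    rcases ht.lt_or_eq with ht | rfl
    · rw [fracPow_of_neg ht]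
    · simp [fracPow, Real.zero_rpow (by linarith : a + b ≠ 0)]
  have hG1 := Real.Gamma_pos_of_pos ha
  have hG2 := Real.Gamma_pos_of_pos (by linarith : 0 < b + 1)
  have hG3 := Real.Gamma_pos_of_pos (by linarith : 0 < a + b + 1)
  have key : ∀ᵐ r : ℝ, rlKernel a (t * r) * fracPow b (t - t * r) =
      ENNReal.ofReal (t ^ (a + b - 1) / Real.Gamma (a + b + 1)) *
        ProbabilityTheory.betaPDF a (b + 1) r := by
    filter_upwards [compl_mem_ae_iff.2 (measure_singleton (1 : ℝ))] with r hr
    rcases le_or_gt r 0 with h0 | h0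
    · rw [rlKernel_of_nonpos (mul_nonpos_of_nonneg_of_nonpos ht.le h0),
        ProbabilityTheory.betaPDF_eq_zero_of_nonpos h0, zero_mul, mul_zero]
    rcases lt_or_ge r 1 with h1 | h1
    · have h2 : t - t * r = t * (1 - r) := by ring
      have h3 : 0 < 1 - r := by linarith
      rw [ProbabilityTheory.betaPDF_of_pos_lt_one h0 h1, rlKernel, if_pos (by positivity),
        fracPow, h2, if_pos (by positivity), ← ENNReal.ofReal_mul (by positivity),
        ← ENNReal.ofReal_mul (by positivity), ProbabilityTheory.beta,
        Real.mul_rpow ht.le h0.le, Real.mul_rpow ht.le h3.le,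
        show a + b - 1 = (a - 1) + b by ring, Real.rpow_add ht, add_sub_cancel_right,
        ← add_assoc]
      congr 1
      field_simp
    · have h2 : 1 < r := lt_of_le_of_ne h1 (Ne.symm hr)
      rw [fracPow_of_neg (by nlinarith), ProbabilityTheory.betaPDF_eq_zero_of_one_le h1,
        mul_zero, mul_zero]
  rw [lintegral_eq_mul_lintegral_comp_mul (by fun_prop) ht, lintegral_congr_ae key,
    lintegral_const_mul' _ _ ENNReal.ofReal_ne_top,
    ProbabilityTheory.lintegral_betaPDF_eq_one ha (by linarith), mul_one,
    ← ENNReal.ofReal_mul ht.le, fracPow, if_pos ht.le, Real.rpow_sub_one ht.ne']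
  congr 1
  field_simp

lemma rlKernel_eq_add_lintegral {a : ℝ} (ha : 0 < a) (ha1 : a ≤ 1) {u y : ℝ} (hu : 0 < u)
    (hy : 0 ≤ y) :
    rlKernel a u = rlKernel a (u + y) +
      ∫⁻ r in Ioi 0, rlKernelSlope a (u + r) * fracPow 0 (y - r) := by
  have hG := Real.Gamma_pos_of_pos ha
  have h1a : 0 ≤ 1 - a := by linarith
  have e1 : ∫⁻ r in Ioi 0, rlKernelSlope a (u + r) * fracPow 0 (y - r) =
      ∫⁻ r in Ioc 0 y, ENNReal.ofReal ((1 - a) * (u + r) ^ (a - 2) / Real.Gamma a) := by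
    rw [← lintegral_indicator measurableSet_Ioi, ← lintegral_indicator measurableSet_Ioc]
    refine lintegral_congr fun r => ?_
    by_cases h0 : 0 < r
    · by_cases h1 : r ≤ y
      · rw [indicator_of_mem (mem_Ioi.2 h0), indicator_of_mem (mem_Ioc.2 ⟨h0, h1⟩),
          fracPow_zero_left (by linarith), mul_one, rlKernelSlope, if_pos (by linarith)]
      · rw [indicator_of_mem (mem_Ioi.2 h0), indicator_of_notMem (fun h => h1 h.2),
          fracPow_of_neg (by linarith), mul_zero]
    · rw [indicator_of_notMem (s := Ioi 0) (fun h => h0 h),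
        indicator_of_notMem (s := Ioc 0 y) (fun h => h0 h.1)]
  have hcont : ContinuousOn (fun r => (1 - a) * (u + r) ^ (a - 2) / Real.Gamma a)
      (uIcc 0 y) := by
    rw [uIcc_of_le hy]
    refine ((continuousOn_const.mul (ContinuousOn.rpow_const (by fun_prop) fun r hr => ?_))).div_const _
    exact Or.inl (by linarith [hr.1])
  have hint := hcont.intervalIntegrable (μ := volume)
  have e2 : ∫ r in (0 : ℝ)..y, (1 - a) * (u + r) ^ (a - 2) / Real.Gamma a =
      -((u + y) ^ (a - 1) / Real.Gamma a) - -((u + 0) ^ (a - 1) / Real.Gamma a) := by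
    refine intervalIntegral.integral_eq_sub_of_hasDerivAt
      (f := fun r => -((u + r) ^ (a - 1) / Real.Gamma a)) (fun r hr => ?_) hint
    rw [uIcc_of_le hy] at hr
    have h := (((hasDerivAt_id r).const_add u).rpow_const (p := a - 1)
      (Or.inl (by simp only [id]; linarith [hr.1]))).div_const (Real.Gamma a) |>.neg
    refine h.congr_deriv ?_
    rw [show a - 1 - 1 = a - 2 by ring]
    simp only [id]
    ring
  rw [e1, ← ofReal_integral_eq_lintegral_ofReal]
  · rw [← intervalIntegral.integral_of_le hy, e2, rlKernel, rlKernel, if_pos hu,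
      if_pos (by linarith), ← ENNReal.ofReal_add (by positivity)]
    · congr 1; rw [add_zero]; ring
    · rw [← e2]
      refine intervalIntegral.integral_nonneg hy fun r hr => ?_
      have : 0 < u + r := by linarith [hr.1]
      positivity
  · exact (intervalIntegrable_iff_integrableOn_Ioc_of_le hy).1 hint
  · filter_upwards [ae_restrict_mem measurableSet_Ioc] with r hr
    have : 0 < u + r := by linarith [hr.1]
    simp only [Pi.zero_apply]
    positivity

lemma lintegral_eq_setLIntegral_Ioi_rlKernel (a : ℝ) (g : ℝ → ℝ≥0∞) :
    ∫⁻ u, rlKernel a u * g u = ∫⁻ u in Ioi 0, rlKernel a u * g u := by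
  rw [← lintegral_indicator measurableSet_Ioi]
  refine lintegral_congr fun u => ?_
  rcases le_or_gt u 0 with hu | hu
  · rw [indicator_of_notMem (s := Ioi 0) hu.not_gt, rlKernel_of_nonpos hu, zero_mul]
  · rw [indicator_of_mem (mem_Ioi.2 hu)]

lemma setLIntegral_Ioi_comp_add {g : ℝ → ℝ≥0∞} (y : ℝ) :
    ∫⁻ u in Ioi 0, g (u + y) = ∫⁻ w in Ioi y, g w := by
  rw [← lintegral_indicator measurableSet_Ioi, ← lintegral_indicator measurableSet_Ioi,
    ← lintegral_add_right_eq_self ((Ioi y).indicator g) y]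
  refine lintegral_congr fun u => ?_
  simp [indicator_apply]

lemma fracPow_add_lintegral {a b : ℝ} (ha : 0 < a) (ha1 : a ≤ 1) (hb : 0 ≤ b) (x : ℝ) {y : ℝ}
    (hy : 0 ≤ y) :
    fracPow (a + b) x + ∫⁻ w in Iic y, rlKernel a w * fracPow b (x + y - w) =
      fracPow (a + b) (x + y) + ∫⁻ u in Ioi 0, ∫⁻ r in Ioi 0,
        rlKernelSlope a (u + r) * (fracPow b (x - u) * fracPow 0 (y - r)) := by
  have e1 : fracPow (a + b) x =
      (∫⁻ w in Ioi y, rlKernel a w * fracPow b (x + y - w)) + ∫⁻ u in Ioi 0, ∫⁻ r in Ioi 0,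
        rlKernelSlope a (u + r) * (fracPow b (x - u) * fracPow 0 (y - r)) := by
    rw [← lintegral_rlKernel_mul_fracPow ha hb, lintegral_eq_setLIntegral_Ioi_rlKernel,
      ← setLIntegral_Ioi_comp_add (g := fun w => rlKernel a w * fracPow b (x + y - w)),
      ← lintegral_add_left (by fun_prop)]
    refine setLIntegral_congr_fun measurableSet_Ioi fun u hu => ?_
    rw [rlKernel_eq_add_lintegral ha ha1 hu hy, add_mul, add_sub_add_right_eq_sub,
      ← lintegral_mul_const _ (by fun_prop)]
    congr 1
    exact lintegral_congr fun r => by ring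
  rw [e1, add_right_comm, add_comm (lintegral _ _), ← compl_Iic,
    lintegral_add_compl _ measurableSet_Iic, lintegral_rlKernel_mul_fracPow ha hb]

lemma binomSum_succ {a : ℝ} (ha : 0 < a) (n : ℕ) (x y : ℝ) :
    binomSum a (n + 1) x y = fracPow (a + a * n) x * fracPow 0 y +
      ∫⁻ w, rlKernel a w * binomSum a n x (y - w) := by
  unfold binomSum
  rw [Finset.Nat.sum_antidiagonal_succ']
  simp only [Finset.mul_sum]
  rw [lintegral_finsetSum _ (by fun_prop)]
  congr 1
  · push_cast; congr 2 <;> ring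
  · refine Finset.sum_congr rfl fun ij _ => ?_
    rw [show a * ((ij.2 + 1 : ℕ) : ℝ) = a + a * ij.2 by push_cast; ring,
      ← lintegral_rlKernel_mul_fracPow ha (by positivity), ← lintegral_const_mul _ (by fun_prop)]
    exact lintegral_congr fun w => by ring

/-- The remainder in the comparison of `binomSum a n x y` with `fracPow (a * n) (x + y)`. -/
noncomputable def remainder (a : ℝ) : ℕ → ℝ → ℝ → ℝ≥0∞
  | 0, _, _ => 0
  | n + 1, x, y => ∫⁻ u in Ioi 0, ∫⁻ r in Ioi 0,
      rlKernelSlope a (u + r) * binomSum a n (x - u) (y - r)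

@[fun_prop]
lemma measurable_remainder (a : ℝ) (n : ℕ) (x : ℝ) : Measurable (remainder a n x) := by
  cases n with
  | zero => exact measurable_const
  | succ n =>
    refine Measurable.lintegral_prod_right (Measurable.lintegral_prod_right ?_)
    unfold Function.uncurry
    fun_prop

lemma lintegral_remainder_add_le {a : ℝ} (ha : 0 < a) (n : ℕ) (x y : ℝ) :
    (∫⁻ u in Ioi 0, ∫⁻ r in Ioi 0,
        rlKernelSlope a (u + r) * (fracPow (a * n) (x - u) * fracPow 0 (y - r))) +
      ∫⁻ w, rlKernel a w * remainder a n x (y - w) ≤ remainder a (n + 1) x y := by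
  cases n with
  | zero => simp [remainder, binomSum]
  | succ n =>
    rw [show a * ((n + 1 : ℕ) : ℝ) = a + a * n by push_cast; ring]
    simp only [remainder, binomSum_succ ha, mul_add]
    have e1 : ∀ w, rlKernel a w * ∫⁻ u in Ioi 0, ∫⁻ r in Ioi 0,
        rlKernelSlope a (u + r) * binomSum a n (x - u) (y - w - r) =
        ∫⁻ u in Ioi 0, ∫⁻ r in Ioi 0, rlKernel a w *
          (rlKernelSlope a (u + r) * binomSum a n (x - u) (y - w - r)) := fun w => by
      rw [← lintegral_const_mul]
      · exact lintegral_congr fun u => (lintegral_const_mul _ (by fun_prop)).symm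
      · refine Measurable.lintegral_prod_right ?_
        unfold Function.uncurry
        fun_prop
    have e2 : ∀ u, ∫⁻ w, ∫⁻ r in Ioi 0, rlKernel a w *
          (rlKernelSlope a (u + r) * binomSum a n (x - u) (y - w - r)) =
        ∫⁻ r in Ioi 0, rlKernelSlope a (u + r) *
          ∫⁻ w, rlKernel a w * binomSum a n (x - u) (y - r - w) := fun u => by
      rw [lintegral_lintegral_swap]
      · refine lintegral_congr fun r => ?_
        rw [← lintegral_const_mul _ (by fun_prop)]
        refine lintegral_congr fun w => ?_
        rw [mul_left_comm, sub_right_comm]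
      · unfold Function.uncurry
        fun_prop
    simp only [e1]
    rw [lintegral_lintegral_swap (f := fun w u => ∫⁻ r in Ioi 0, rlKernel a w *
      (rlKernelSlope a (u + r) * binomSum a n (x - u) (y - w - r)))]
    · simp only [e2]
      rw [← lintegral_add_left]
      · refine lintegral_mono fun u => ?_
        rw [← lintegral_add_left (by fun_prop)]
      · refine Measurable.lintegral_prod_right ?_
        unfold Function.uncurry
        fun_prop
    · refine Measurable.aemeasurable (Measurable.lintegral_prod_right ?_)
      unfold Function.uncurry
      fun_prop

lemma binomSum_le_add_remainder {a : ℝ} (ha : 0 < a) (ha1 : a ≤ 1) (n : ℕ) {x y : ℝ}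
    (hx : 0 ≤ x) (hy : 0 ≤ y) :
    binomSum a n x y ≤ fracPow (a * n) (x + y) + remainder a n x y := by
  induction n generalizing y with
  | zero => simp [binomSum, fracPow_zero_left, hx, hy, add_nonneg]
  | succ n ih =>
    have hb : 0 ≤ a * n := by positivity
    have h1 : ∫⁻ w, rlKernel a w * binomSum a n x (y - w) ≤
        (∫⁻ w in Iic y, rlKernel a w * fracPow (a * n) (x + y - w)) +
          ∫⁻ w, rlKernel a w * remainder a n x (y - w) := by
      rw [← lintegral_indicator measurableSet_Iic, ← lintegral_add_right _ (by fun_prop)]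
      refine lintegral_mono fun w => ?_
      by_cases hw : w ≤ y
      · rw [indicator_of_mem (mem_Iic.2 hw), ← mul_add, add_sub_assoc]
        gcongr
        exact ih (by linarith)
      · rw [binomSum_of_neg_right (by linarith), mul_zero]
        exact zero_le
    rw [binomSum_succ ha, fracPow_zero_left hy, mul_one,
      show a * ((n + 1 : ℕ) : ℝ) = a + a * n by push_cast; ring]
    calc _ ≤ fracPow (a + a * n) x + ((∫⁻ w in Iic y, rlKernel a w * fracPow (a * n) (x + y - w)) +
          ∫⁻ w, rlKernel a w * remainder a n x (y - w)) := by gcongr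
      _ ≤ _ := by
        rw [← add_assoc, fracPow_add_lintegral ha ha1 hb x hy, add_assoc]
        gcongr
        exact lintegral_remainder_add_le ha n x y

lemma lintegral_lintegral_rlKernelSlope {a b : ℝ} (ha : 0 < a) (ha1 : a ≤ 1) (hb : 0 ≤ b) (z : ℝ) :
    ∫⁻ u in Ioi 0, ∫⁻ r in Ioi 0, rlKernelSlope a (u + r) * fracPow b (z - (u + r)) =
      ENNReal.ofReal (1 - a) * fracPow (a + b) z := by
  have e1 : ∀ u : ℝ, ∫⁻ r in Ioi 0, rlKernelSlope a (u + r) * fracPow b (z - (u + r)) =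
      ∫⁻ t, (Ioi u).indicator (fun t => rlKernelSlope a t * fracPow b (z - t)) t := fun u => by
    rw [lintegral_indicator measurableSet_Ioi,
      ← setLIntegral_Ioi_comp_add (g := fun t => rlKernelSlope a t * fracPow b (z - t))]
    simp only [add_comm u]
  simp only [e1]
  rw [lintegral_lintegral_swap, ← lintegral_rlKernel_mul_fracPow ha hb,
    ← lintegral_const_mul _ (by fun_prop)]
  · refine lintegral_congr fun t => ?_
    have e2 : ∫⁻ u in Ioi 0,
        (Ioi u).indicator (fun t => rlKernelSlope a t * fracPow b (z - t)) t =
        ∫⁻ u in Ioo 0 t, rlKernelSlope a t * fracPow b (z - t) := by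
      rw [← lintegral_indicator measurableSet_Ioi, ← lintegral_indicator measurableSet_Ioo]
      refine lintegral_congr fun u => ?_
      simp only [indicator_apply, mem_Ioi, mem_Ioo, ite_and]
    rw [e2, setLIntegral_const, Real.volume_Ioo, sub_zero, mul_right_comm, ← mul_assoc]
    congr 1
    rcases le_or_gt t 0 with ht | ht
    · rw [ENNReal.ofReal_of_nonpos ht, mul_zero, rlKernel_of_nonpos ht, mul_zero]
    · have hG := Real.Gamma_pos_of_pos ha
      have h1a : 0 ≤ 1 - a := by linarith
      rw [rlKernelSlope, rlKernel, if_pos ht, if_pos ht, ← ENNReal.ofReal_mul (by positivity),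
        ← ENNReal.ofReal_mul h1a, show a - 1 = a - 2 + 1 by ring, Real.rpow_add_one ht.ne']
      congr 1
      ring
  · refine Measurable.aemeasurable ?_
    have : Measurable (({q : ℝ × ℝ | q.1 < q.2}).indicator
        fun q : ℝ × ℝ => rlKernelSlope a q.2 * fracPow b (z - q.2)) :=
      Measurable.indicator (by fun_prop) (measurableSet_lt measurable_fst measurable_snd)
    exact this

lemma binomSum_le {a : ℝ} (ha : 0 < a) (ha1 : a ≤ 1) (n : ℕ) (x y : ℝ) :
    binomSum a n x y ≤ ENNReal.ofReal a⁻¹ * fracPow (a * n) (x + y) := by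
  induction n generalizing x y with
  | zero =>
    rcases lt_or_ge x 0 with hx | hx
    · simp [binomSum_of_neg_left hx]
    rcases lt_or_ge y 0 with hy | hy
    · simp [binomSum_of_neg_right hy]
    simp [binomSum, fracPow_zero_left, hx, hy, add_nonneg, one_le_inv₀ ha, ha1]
  | succ n ih =>
    rcases lt_or_ge x 0 with hx | hx
    · simp [binomSum_of_neg_left hx]
    rcases lt_or_ge y 0 with hy | hy
    · simp [binomSum_of_neg_right hy]
    have hc : ENNReal.ofReal a⁻¹ = 1 + ENNReal.ofReal a⁻¹ * ENNReal.ofReal (1 - a) := by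
      rw [← ENNReal.ofReal_mul (by positivity), ← ENNReal.ofReal_one,
        ← ENNReal.ofReal_add zero_le_one (mul_nonneg (by positivity) (by linarith))]
      congr 1
      field_simp
      ring
    have h1 : remainder a (n + 1) x y ≤
        ENNReal.ofReal a⁻¹ * (ENNReal.ofReal (1 - a) * fracPow (a + a * n) (x + y)) := by
      rw [← lintegral_lintegral_rlKernelSlope ha ha1 (by positivity),
        ← lintegral_const_mul' _ _ ENNReal.ofReal_ne_top, remainder]
      refine lintegral_mono fun u => ?_
      rw [← lintegral_const_mul' _ _ ENNReal.ofReal_ne_top]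
      refine lintegral_mono fun r => ?_
      rw [mul_left_comm, ← sub_add_sub_comm]
      gcongr
      exact ih _ _
    refine (binomSum_le_add_remainder ha ha1 (n + 1) hx hy).trans ?_
    rw [show a * ((n + 1 : ℕ) : ℝ) = a + a * n by push_cast; ring]
    calc _ ≤ _ := add_le_add_right h1 _
      _ = _ := by
        conv_rhs => rw [hc]
        ring

/-- The two-variable neo-classical inequality with the sharp constant. -/
theorem sum_antidiagonal_le {p : ℝ} (hp : 1 ≤ p) (k : ℕ) {x y : ℝ} (hx : 0 ≤ x) (hy : 0 ≤ y) :
    ∑ ij ∈ Finset.HasAntidiagonal.antidiagonal k, x ^ ((ij.1 : ℝ) / p) / Real.Gamma ((ij.1 : ℝ) / p + 1) *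
        (y ^ ((ij.2 : ℝ) / p) / Real.Gamma ((ij.2 : ℝ) / p + 1)) ≤
      p * ((x + y) ^ ((k : ℝ) / p) / Real.Gamma ((k : ℝ) / p + 1)) := by
  have hp0 : 0 < p := by linarith
  have hnn : ∀ (n : ℕ) {t : ℝ}, 0 ≤ t → 0 ≤ t ^ ((n : ℝ) / p) / Real.Gamma ((n : ℝ) / p + 1) :=
    fun n t ht => div_nonneg (Real.rpow_nonneg ht _) (Real.Gamma_pos_of_pos (by positivity)).le
  have h := binomSum_le (inv_pos.2 hp0) (inv_le_one_of_one_le₀ hp) k x y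
  simp only [binomSum, fracPow, hx, hy, add_nonneg, if_true, inv_inv, ← div_eq_inv_mul] at h
  rw [← ENNReal.ofReal_mul hp0.le] at h
  simp only [← ENNReal.ofReal_mul (hnn _ hx)] at h
  rwa [← ENNReal.ofReal_sum_of_nonneg fun ij _ => mul_nonneg (hnn _ hx) (hnn _ hy),
    ENNReal.ofReal_le_ofReal_iff (mul_nonneg hp0.le (hnn _ (add_nonneg hx hy)))] at h

lemma sum_antidiagonalTuple_succ {M : Type*} [AddCommMonoid M] (m k : ℕ)
    (f : (Fin (m + 1) → ℕ) → M) :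
    ∑ s ∈ Finset.Nat.antidiagonalTuple (m + 1) k, f s =
      ∑ ij ∈ Finset.HasAntidiagonal.antidiagonal k, ∑ s ∈ Finset.Nat.antidiagonalTuple m ij.2,
        f (Fin.cons ij.1 s) := by
  rw [Finset.sum_sigma']
  refine Finset.sum_bij' (fun s _ => ⟨(s 0, ∑ i, Fin.tail s i), Fin.tail s⟩)
    (fun s _ => Fin.cons s.1.1 s.2) ?_ ?_ ?_ ?_ ?_
  · simp [Finset.Nat.mem_antidiagonalTuple, Fin.sum_univ_succ, Fin.tail]
  · rintro ⟨⟨i, j⟩, s⟩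
    simp +contextual [Finset.Nat.mem_antidiagonalTuple, Fin.sum_univ_succ]
  · simp
  · rintro ⟨⟨i, j⟩, s⟩
    simp +contextual [Finset.Nat.mem_antidiagonalTuple]
  · simp

theorem sum_antidiagonalTuple_le {p : ℝ} (hp : 1 ≤ p) (m k : ℕ) (x : Fin (m + 1) → ℝ)
    (hx : ∀ i, 0 ≤ x i) :
    ∑ s ∈ Finset.Nat.antidiagonalTuple (m + 1) k,
        ∏ i, x i ^ ((s i : ℝ) / p) / Real.Gamma ((s i : ℝ) / p + 1) ≤
      p ^ m * ((∑ i, x i) ^ ((k : ℝ) / p) / Real.Gamma ((k : ℝ) / p + 1)) := by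
  have hp0 : 0 < p := by linarith
  induction m generalizing k with
  | zero => simp
  | succ m ih =>
    rw [sum_antidiagonalTuple_succ]
    simp only [Fin.prod_univ_succ (n := m + 1), Fin.cons_zero, Fin.cons_succ, ← Finset.mul_sum]
    rw [Fin.sum_univ_succ]
    calc _ ≤ ∑ ij ∈ Finset.HasAntidiagonal.antidiagonal k,
          x 0 ^ ((ij.1 : ℝ) / p) / Real.Gamma ((ij.1 : ℝ) / p + 1) *
            (p ^ m * ((∑ i : Fin (m + 1), x i.succ) ^ ((ij.2 : ℝ) / p) /
              Real.Gamma ((ij.2 : ℝ) / p + 1))) := by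
          refine Finset.sum_le_sum fun ij _ => mul_le_mul_of_nonneg_left
            (ih ij.2 (fun i => x i.succ) fun i => hx _) ?_
          exact div_nonneg (Real.rpow_nonneg (hx 0) _)
            (Real.Gamma_pos_of_pos (by positivity)).le
      _ ≤ p ^ m * (p * ((x 0 + ∑ i : Fin (m + 1), x i.succ) ^ ((k : ℝ) / p) /
            Real.Gamma ((k : ℝ) / p + 1))) := by
          simp only [mul_left_comm _ (p ^ m), ← Finset.mul_sum]
          gcongr
          exact sum_antidiagonal_le hp k (hx 0) (Finset.sum_nonneg fun i _ => hx _)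
      _ = _ := by ring

end NeoClassical

/-- The neo-classical inequality. -/
theorem neo_classical_inequality (p : ℝ) (hp : 1 ≤ p) (m k : ℕ) (hm : 1 ≤ m)
    (x : Fin m → ℝ) (hx : ∀ i, 0 ≤ x i) :
    ∑ s ∈ Finset.Nat.antidiagonalTuple m k,
        ∏ i, x i ^ ((s i : ℝ) / p) / Real.Gamma ((s i : ℝ) / p + 1) ≤
      p ^ (2 * m - 2) *
        ((∑ i, x i) ^ ((k : ℝ) / p) / Real.Gamma ((k : ℝ) / p + 1)) := by
  obtain ⟨m, rfl⟩ := Nat.exists_eq_add_of_le' hm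
  refine (NeoClassical.sum_antidiagonalTuple_le hp m k x hx).trans ?_
  have hp0 : 0 < p := by linarith
  have h0 : 0 ≤ ∑ i, x i := Finset.sum_nonneg fun i _ => hx i
  have hG := Real.Gamma_pos_of_pos (by positivity : 0 < (k : ℝ) / p + 1)
  gcongr
  lia
end

section
/- (Group-valued solution of the log-ODE) If y : [0,1] → L^{[p]}(U) solves dy_u = y_u ⊗ dγ_u where γ : [0,1] → [U]^1 ⊕ [U]^2 ⊕ ⋯ ⊕ [U]^{[p]} is a differentiable path with values in Lie polynomials of degree [p] (with γ_0 = 0 and y_0 = 1), then y takes values in the step-[p] free nilpotent group G^{[p]}(U) = {exp(a) : a ∈ [U]^1 ⊕ ⋯ ⊕ [U]^{[p]}}. -/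
/-!
Statement 18 (group-valued solution of the log-ODE): if
`y : [0,1] → L^{[p]}(U)` solves `dy_u = y_u ⊗ dγ_u` with `y₀ = 1`, where
`γ` is a differentiable path with `γ₀ = 0` taking values in the Lie
polynomials `[U]^1 ⊕ ⋯ ⊕ [U]^{[p]}` (closures of spans of iterated brackets
`[v₁,[v₂,…,[v_{k−1},v_k]]]`, `[u,v] = u⊗v − v⊗u`), then `y` takes values in
the step-`[p]` free nilpotent group `G^{[p]}(U) = exp([U]^1 ⊕ ⋯ ⊕ [U]^{[p]})`.
The truncated tensor algebra is modelled by a graded family `W : ℕ → Type`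
(`W k ≅ U^{⊗k}`) of Banach spaces with admissible associative unital bilinear
multiplication `μ`; `N` plays the role of `[p]`.
-/

noncomputable section
open scoped BigOperators

variable {W : ℕ → Type*} [∀ k, NormedAddCommGroup (W k)] [∀ k, NormedSpace ℝ (W k)]

def castW {i j : ℕ} (h : i = j) (x : W i) : W j := h ▸ x

def truncMul (μ : ∀ i j, W i →ₗ[ℝ] W j →ₗ[ℝ] W (i + j)) (g h : ∀ k, W k) : ∀ k, W k :=
  fun k => ∑ j : Fin (k + 1),
    castW (Nat.add_sub_cancel' j.is_le) (μ (j : ℕ) (k - (j : ℕ)) (g (j : ℕ)) (h (k - (j : ℕ))))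

def unitT (e : W 0) : ∀ k, W k
  | 0 => e
  | _ + 1 => 0

def tpow (μ : ∀ i j, W i →ₗ[ℝ] W j →ₗ[ℝ] W (i + j)) (e : W 0) (x : ∀ k, W k) :
    ℕ → ∀ k, W k
  | 0 => unitT e
  | j + 1 => truncMul μ x (tpow μ e x j)

/-- truncated exponential -/
def expT (μ : ∀ i j, W i →ₗ[ℝ] W j →ₗ[ℝ] W (i + j)) (e : W 0) (n : ℕ)
    (a : ∀ k, W k) : ∀ k, W k :=
  unitT e + ∑ j ∈ Finset.Icc 1 n, ((j.factorial : ℝ))⁻¹ • tpow μ e a j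

/-- the bracket `[x,y] = x ⊗ y − y ⊗ x` of homogeneous elements -/
def bra (μ : ∀ i j, W i →ₗ[ℝ] W j →ₗ[ℝ] W (i + j)) {i j : ℕ}
    (x : W i) (y : W j) : W (i + j) :=
  μ i j x y - castW (Nat.add_comm j i) (μ j i y x)

/-- the degree-`k` Lie polynomials `[U]^k`: the closure of the span of the
iterated brackets `[v₁,[v₂,…,[v_{k−1},v_k]]]`. -/
def LieLevel (μ : ∀ i j, W i →ₗ[ℝ] W j →ₗ[ℝ] W (i + j)) :
    (k : ℕ) → Submodule ℝ (W k)
  | 0 => ⊥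
  | 1 => ⊤
  | (k + 2) =>
      (Submodule.span ℝ {z : W (k + 2) | ∃ (v : W 1) (w : W (k + 1)),
          w ∈ LieLevel μ (k + 1) ∧
          z = castW (Nat.add_comm 1 (k + 1)) (bra μ v w)}).topologicalClosure


open Finset.HasAntidiagonal (antidiagonal)

/-- `dPow a b n` is the derivative of `a ^ n` in the direction `b`. -/
def dPow {A : Type*} [Ring A] (a b : A) : ℕ → A
  | 0 => 0
  | n + 1 => b * a ^ n + a * dPow a b n

section OppositeAdjoint

variable {A : Type*} [Ring A] [Algebra ℝ A]

/-- The map `z ↦ z * a - a * z`. -/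
def negAd (a : A) : Module.End ℝ A := LinearMap.mulRight ℝ a - LinearMap.mulLeft ℝ a

@[simp] theorem negAd_apply (a z : A) : negAd a z = z * a - a * z := rfl

theorem mul_pow_eq_sum_negAd (a b : A) (n : ℕ) :
    b * a ^ n = ∑ p ∈ antidiagonal n, n.choose p.1 • (a ^ p.1 * (negAd a ^ p.2) b) := by
  have hc : Commute (LinearMap.mulLeft ℝ a) (negAd a) := by
    refine LinearMap.ext fun z => ?_
    simp [mul_sub, mul_assoc]
  have h := hc.add_pow' n
  have hR : LinearMap.mulLeft ℝ a + negAd a = LinearMap.mulRight ℝ a := by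
    simp [negAd]
  rw [hR] at h
  have := congrArg (fun f : Module.End ℝ A => f b) h
  simpa [LinearMap.pow_mulRight, LinearMap.pow_mulLeft, LinearMap.sum_apply] using this

theorem dPow_succ_eq_sum_negAd (a b : A) (n : ℕ) :
    dPow a b (n + 1) =
      ∑ p ∈ antidiagonal n, (n + 1).choose p.1 • (a ^ p.1 * (negAd a ^ p.2) b) := by
  induction n with
  | zero => simp [dPow]
  | succ n ih =>
    rw [dPow, ih, mul_pow_eq_sum_negAd, Finset.Nat.sum_antidiagonal_succ,
      Finset.Nat.sum_antidiagonal_succ, Finset.mul_sum, add_assoc, ← Finset.sum_add_distrib]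
    congr 1
    refine Finset.sum_congr rfl fun p _ => ?_
    rw [Nat.choose_succ_succ (n + 1) p.1, add_smul, add_comm, mul_smul_comm, pow_succ' a p.1,
      mul_assoc]

/-- The right logarithmic derivative of `exp a` in the direction `b`, truncated at order `N`. -/
def logDerivT (N : ℕ) (a b : A) : A :=
  ∑ m ∈ Finset.range N, ((m + 1).factorial : ℝ)⁻¹ • (negAd a ^ m) b

theorem sum_dPow_eq (a b : A) (N : ℕ) :
    ∑ j ∈ Finset.range (N + 1), (j.factorial : ℝ)⁻¹ • dPow a b j =
      ∑ q ∈ Finset.range N, ∑ m ∈ Finset.range (N - q),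
        ((q.factorial : ℝ)⁻¹ • a ^ q) * (((m + 1).factorial : ℝ)⁻¹ • (negAd a ^ m) b) := by
  rw [Finset.sum_range_succ', ← Finset.sum_range_diag_flip]
  simp only [dPow, smul_zero, add_zero]
  refine Finset.sum_congr rfl fun j _ => ?_
  rw [← Finset.Nat.sum_antidiagonal_eq_sum_range_succ
    (fun q m => ((q.factorial : ℝ)⁻¹ • a ^ q) * (((m + 1).factorial : ℝ)⁻¹ • (negAd a ^ m) b)),
    ← dPow, dPow_succ_eq_sum_negAd, Finset.smul_sum]
  refine Finset.sum_congr rfl fun p hp => ?_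
  obtain rfl := Finset.HasAntidiagonal.mem_antidiagonal.1 hp
  rw [smul_mul_smul_comm, ← Nat.cast_smul_eq_nsmul ℝ, smul_smul]
  congr 1
  rw [add_assoc, Nat.choose_symm_add, Nat.add_choose]
  rw [Nat.cast_div (Nat.factorial_mul_factorial_dvd_factorial_add _ _) (by positivity)]
  push_cast
  field_simp

end OppositeAdjoint

variable (W) in
/-- A bounded associative unital multiplication on a graded family, indexed so that no transport
along equalities of degrees is needed; only the values at `k = i + j` are relevant. -/
structure GradedMul where
  mul : ∀ i j k : ℕ, W i →L[ℝ] W j →L[ℝ] W k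
  one : W 0
  one_mul : ∀ j (x : W j), mul 0 j j one x = x
  mul_one : ∀ j (x : W j), mul j 0 j x one = x
  mul_assoc : ∀ i j k l s t, i + j = s → j + k = l → i + j + k = t →
    ∀ (x : W i) (y : W j) (z : W k), mul s k t (mul i j s x y) z = mul i l t x (mul j k l y z)

namespace GradedMul

/-- Formal series `∑ x_k` with `x_k` of degree `k`. -/
def Series (_ : GradedMul W) := ∀ k, W k

variable {B : GradedMul W}

instance : AddCommGroup B.Series := inferInstanceAs (AddCommGroup (∀ k, W k))
instance : Module ℝ B.Series := inferInstanceAs (Module ℝ (∀ k, W k))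
instance : Mul B.Series :=
  ⟨fun x y k => ∑ p ∈ antidiagonal k, B.mul p.1 p.2 k (x p.1) (y p.2)⟩
instance : One B.Series := ⟨unitT B.one⟩

namespace Series

theorem mul_apply (x y : B.Series) (k : ℕ) :
    (x * y) k = ∑ p ∈ antidiagonal k, B.mul p.1 p.2 k (x p.1) (y p.2) := rfl
theorem one_apply_zero : (1 : B.Series) 0 = B.one := rfl
theorem one_apply_succ (k : ℕ) : (1 : B.Series) (k + 1) = 0 := rfl
@[simp] theorem add_apply (x y : B.Series) (k : ℕ) : (x + y) k = x k + y k := rfl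
@[simp] theorem sub_apply (x y : B.Series) (k : ℕ) : (x - y) k = x k - y k := rfl
@[simp] theorem zero_apply (k : ℕ) : (0 : B.Series) k = 0 := rfl
@[simp] theorem smul_apply (c : ℝ) (x : B.Series) (k : ℕ) : (c • x) k = c • x k := rfl

theorem sum_apply {ι : Type*} (s : Finset ι) (f : ι → B.Series) (k : ℕ) :
    (∑ i ∈ s, f i) k = ∑ i ∈ s, f i k :=
  Finset.sum_apply k s f

protected theorem one_mul (x : B.Series) : 1 * x = x := by
  funext k
  cases k with
  | zero => exact (Finset.sum_singleton _ _).trans (B.one_mul 0 (x 0))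
  | succ k =>
    rw [mul_apply, Finset.Nat.sum_antidiagonal_succ, Finset.sum_eq_zero, add_zero]
    · exact B.one_mul _ _
    · intro p _
      rw [one_apply_succ, map_zero, _root_.zero_apply]

protected theorem mul_one (x : B.Series) : x * 1 = x := by
  funext k
  cases k with
  | zero => exact (Finset.sum_singleton _ _).trans (B.mul_one 0 (x 0))
  | succ k =>
    rw [mul_apply, Finset.Nat.sum_antidiagonal_succ', Finset.sum_eq_zero, add_zero]
    · exact B.mul_one _ _
    · intro p _
      rw [one_apply_succ, map_zero]

protected theorem mul_assoc (x y z : B.Series) : x * y * z = x * (y * z) := by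
  funext n
  simp only [mul_apply, map_sum, Finset.sum_sigma', _root_.sum_apply]
  apply Finset.sum_nbij' (fun ⟨⟨_i, j⟩, ⟨k, l⟩⟩ ↦ ⟨(k, l + j), (l, j)⟩)
    (fun ⟨⟨i, _j⟩, ⟨k, l⟩⟩ ↦ ⟨(i + k, l), (i, k)⟩)
  case h =>
    rintro ⟨⟨i, j⟩, ⟨k, l⟩⟩ h
    simp only [Finset.mem_sigma, Finset.HasAntidiagonal.mem_antidiagonal] at h
    exact B.mul_assoc k l j _ _ _ h.2 rfl (by omega) _ _ _
  all_goals
    rintro ⟨⟨i, j⟩, ⟨k, l⟩⟩ h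
    simp only [Finset.mem_sigma, Finset.HasAntidiagonal.mem_antidiagonal] at h
    obtain ⟨rfl, rfl⟩ := h
    simp [add_assoc]

end Series

instance : Ring B.Series :=
  { (inferInstance : AddCommGroup B.Series), (inferInstance : Mul B.Series),
    (inferInstance : One B.Series) with
    one_mul := Series.one_mul
    mul_one := Series.mul_one
    mul_assoc := Series.mul_assoc
    zero_mul x := by funext k; simp [Series.mul_apply]
    mul_zero x := by funext k; simp [Series.mul_apply]
    left_distrib x y z := by funext k; simp [Series.mul_apply, Finset.sum_add_distrib]
    right_distrib x y z := by funext k; simp [Series.mul_apply, Finset.sum_add_distrib] }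

instance : Algebra ℝ B.Series :=
  Algebra.ofModule (fun c x y => by funext k; simp [Series.mul_apply, Finset.smul_sum])
    (fun c x y => by funext k; simp [Series.mul_apply, Finset.smul_sum])

/-! ### Order of a series -/

namespace Series

/-- All terms of degree `< q` vanish. -/
def OrderGE (q : ℕ) (x : B.Series) : Prop := ∀ k < q, x k = 0

theorem OrderGE.mono {p q : ℕ} {x : B.Series} (h : OrderGE q x) (hpq : p ≤ q) : OrderGE p x :=
  fun k hk => h k (hk.trans_le hpq)

theorem OrderGE.add {q : ℕ} {x y : B.Series} (hx : OrderGE q x) (hy : OrderGE q y) :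
    OrderGE q (x + y) := fun k hk => by simp [hx k hk, hy k hk]

theorem OrderGE.sub {q : ℕ} {x y : B.Series} (hx : OrderGE q x) (hy : OrderGE q y) :
    OrderGE q (x - y) := fun k hk => by simp [hx k hk, hy k hk]

theorem OrderGE.smul {q : ℕ} {x : B.Series} (c : ℝ) (hx : OrderGE q x) : OrderGE q (c • x) :=
  fun k hk => by simp [hx k hk]

theorem OrderGE.sum {ι : Type*} {s : Finset ι} {q : ℕ} {f : ι → B.Series}
    (h : ∀ i ∈ s, OrderGE q (f i)) : OrderGE q (∑ i ∈ s, f i) := fun k hk => by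
  rw [sum_apply]
  exact Finset.sum_eq_zero fun i hi => h i hi k hk

theorem OrderGE.mul {p q : ℕ} {x y : B.Series} (hx : OrderGE p x) (hy : OrderGE q y) :
    OrderGE (p + q) (x * y) := fun k hk => by
  rw [mul_apply]
  refine Finset.sum_eq_zero fun r hr => ?_
  rw [Finset.HasAntidiagonal.mem_antidiagonal] at hr
  by_cases h : r.1 < p
  · rw [hx _ h, map_zero, _root_.zero_apply]
  · rw [hy r.2 (by omega), map_zero]

theorem OrderGE.pow {x : B.Series} (hx : OrderGE 1 x) (n : ℕ) : OrderGE n (x ^ n) := by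
  induction n with
  | zero => exact fun k hk => absurd hk (Nat.not_lt_zero k)
  | succ n ih => rw [pow_succ]; exact ih.mul hx

theorem OrderGE.negAd {p q : ℕ} {a z : B.Series} (ha : OrderGE p a) (hz : OrderGE q z) :
    OrderGE (q + p) (negAd a z) :=
  (hz.mul ha).sub ((ha.mul hz).mono (by omega))

theorem OrderGE.negAd_pow {q : ℕ} {a z : B.Series} (ha : OrderGE 1 a) (hz : OrderGE q z) (m : ℕ) :
    OrderGE (q + m) ((_root_.negAd a ^ m) z) := by
  induction m with
  | zero => simpa using hz
  | succ m ih =>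
    rw [pow_succ', Module.End.mul_apply, ← add_assoc]
    exact ha.negAd ih

theorem negAd_pow_add_sub {n : ℕ} {a b c d : B.Series} (ha : OrderGE 1 a) (hb : OrderGE 1 b)
    (hc : OrderGE (n + 1) c) (hd : OrderGE (n + 1) d) (m : ℕ) :
    OrderGE (n + 1 + m) ((negAd (a + c) ^ m) (b + d) - (negAd a ^ m) b) := by
  induction m with
  | zero => simpa using hd
  | succ m ih =>
    rw [pow_succ', pow_succ', Module.End.mul_apply, Module.End.mul_apply]
    have h : negAd (a + c) ((negAd (a + c) ^ m) (b + d)) - negAd a ((negAd a ^ m) b) =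
        negAd (a + c) ((negAd (a + c) ^ m) (b + d) - (negAd a ^ m) b) +
          negAd c ((negAd a ^ m) b) := by
      simp only [negAd_apply, mul_add, add_mul, mul_sub, sub_mul]
      abel
    rw [h]
    exact ((ha.add (hc.mono (by omega))).negAd ih).add
      ((hc.negAd (ha.negAd_pow hb m)).mono (by omega))

theorem logDerivT_add_apply {N n k : ℕ} (hN : 1 ≤ N) {a b c d : B.Series} (ha : OrderGE 1 a)
    (hb : OrderGE 1 b) (hc : OrderGE (n + 1) c) (hd : OrderGE (n + 1) d) (hk : k ≤ n + 1) :
    logDerivT N (a + c) (b + d) k = logDerivT N a b k + d k := by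
  obtain ⟨N, rfl⟩ := Nat.exists_eq_add_of_le' hN
  have h : OrderGE (n + 2) (logDerivT (N + 1) (a + c) (b + d) - logDerivT (N + 1) a b - d) := by
    have e : logDerivT (N + 1) (a + c) (b + d) - logDerivT (N + 1) a b - d =
        ∑ m ∈ Finset.range N, ((m + 1 + 1).factorial : ℝ)⁻¹ •
          ((negAd (a + c) ^ (m + 1)) (b + d) - (negAd a ^ (m + 1)) b) := by
      simp only [logDerivT, Finset.sum_range_succ', smul_sub, Finset.sum_sub_distrib]
      simp
      abel
    rw [e]
    exact OrderGE.sum fun m _ =>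
      ((negAd_pow_add_sub ha hb hc hd (m + 1)).mono (by omega)).smul _
  have := h k (by omega)
  rw [sub_apply, sub_apply, sub_sub, sub_eq_zero] at this
  exact this

variable (B) in
/-- The partial sum `∑_{j ≤ N} a ^ j / j!` of the exponential series. -/
def expSum (N : ℕ) (a : B.Series) : B.Series :=
  ∑ j ∈ Finset.range (N + 1), (j.factorial : ℝ)⁻¹ • a ^ j

theorem sum_dPow_apply {N k : ℕ} (hk : k ≤ N) {a b : B.Series} (ha : OrderGE 1 a)
    (hb : OrderGE 1 b) :
    (∑ j ∈ Finset.range (N + 1), (j.factorial : ℝ)⁻¹ • dPow a b j) k =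
      (expSum B N a * logDerivT N a b) k := by
  have hT : ∀ q m, N ≤ q + m → (((q.factorial : ℝ)⁻¹ • a ^ q) *
      (((m + 1).factorial : ℝ)⁻¹ • (negAd a ^ m) b)) k = 0 := fun q m h =>
    (((ha.pow q).smul _).mul ((ha.negAd_pow hb m).smul _)) k (by omega)
  rw [sum_dPow_eq, expSum, logDerivT, Finset.sum_mul, Finset.sum_range_succ]
  simp only [Finset.mul_sum, sum_apply, add_apply]
  rw [Finset.sum_eq_zero (fun m _ => hT N m (by omega)), add_zero]
  refine Finset.sum_congr rfl fun q _ => ?_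
  refine Finset.sum_subset (fun m hm => ?_) fun m _ hm => hT q m ?_
  · simp only [Finset.mem_range] at hm ⊢; omega
  · simp only [Finset.mem_range] at hm; omega

/-! ### Differentiable paths of series -/

/-- Termwise derivative of a path of series. -/
def HasDeriv (x x' : ℝ → B.Series) : Prop := ∀ k t, HasDerivAt (fun s => x s k) (x' t k) t

/-- Termwise continuity of a path of series. -/
def ContPath (x : ℝ → B.Series) : Prop := ∀ k, Continuous fun s => x s k

theorem HasDeriv.contPath {x x' : ℝ → B.Series} (h : HasDeriv x x') : ContPath x :=
  fun k => continuous_iff_continuousAt.2 fun t => (h k t).continuousAt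

theorem HasDeriv.add {x x' y y' : ℝ → B.Series} (hx : HasDeriv x x') (hy : HasDeriv y y') :
    HasDeriv (fun t => x t + y t) (fun t => x' t + y' t) :=
  fun k t => (hx k t).fun_add (hy k t)

theorem HasDeriv.smul {x x' : ℝ → B.Series} (c : ℝ) (hx : HasDeriv x x') :
    HasDeriv (fun t => c • x t) (fun t => c • x' t) :=
  fun k t => (hx k t).fun_const_smul c

theorem HasDeriv.sum {ι : Type*} {s : Finset ι} {x x' : ι → ℝ → B.Series}
    (h : ∀ i ∈ s, HasDeriv (x i) (x' i)) :
    HasDeriv (fun t => ∑ i ∈ s, x i t) (fun t => ∑ i ∈ s, x' i t) := fun k t => by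
  simp only [sum_apply]
  exact HasDerivAt.fun_sum fun i hi => h i hi k t

theorem HasDeriv.mul {x x' y y' : ℝ → B.Series} (hx : HasDeriv x x') (hy : HasDeriv y y') :
    HasDeriv (fun t => x t * y t) (fun t => x' t * y t + x t * y' t) := fun k t => by
  simp only [mul_apply, add_apply]
  rw [← Finset.sum_add_distrib]
  refine HasDerivAt.fun_sum fun p _ => ?_
  rw [add_comm]
  exact (B.mul p.1 p.2 k).hasDerivAt_of_bilinear (fun _ => hx p.1 t) (fun _ => hy p.2 t)

theorem HasDeriv.pow {a a' : ℝ → B.Series} (h : HasDeriv a a') (n : ℕ) :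
    HasDeriv (fun t => a t ^ n) (fun t => dPow (a t) (a' t) n) := by
  induction n with
  | zero => exact fun k t => by simpa [dPow] using! hasDerivAt_const t ((1 : B.Series) k)
  | succ n ih =>
    simp only [pow_succ', dPow]
    exact h.mul ih

theorem HasDeriv.expSum_apply {a a' : ℝ → B.Series} (h : HasDeriv a a')
    (ha : ∀ t, OrderGE 1 (a t)) (ha' : ∀ t, OrderGE 1 (a' t)) {N k : ℕ} (hk : k ≤ N) (t : ℝ) :
    HasDerivAt (fun s => expSum B N (a s) k)
      ((expSum B N (a t) * logDerivT N (a t) (a' t)) k) t := by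
  rw [← sum_dPow_apply hk (ha t) (ha' t)]
  exact (HasDeriv.sum (s := Finset.range (N + 1)) fun j _ => (h.pow j).smul _) k t

theorem ContPath.add {x y : ℝ → B.Series} (hx : ContPath x) (hy : ContPath y) :
    ContPath (fun t => x t + y t) := fun k => (hx k).add (hy k)

theorem ContPath.sub {x y : ℝ → B.Series} (hx : ContPath x) (hy : ContPath y) :
    ContPath (fun t => x t - y t) := fun k => (hx k).sub (hy k)

theorem ContPath.smul {x : ℝ → B.Series} (c : ℝ) (hx : ContPath x) :
    ContPath (fun t => c • x t) := fun k => (hx k).const_smul c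

theorem ContPath.sum {ι : Type*} {s : Finset ι} {x : ι → ℝ → B.Series}
    (h : ∀ i ∈ s, ContPath (x i)) : ContPath (fun t => ∑ i ∈ s, x i t) := fun k => by
  simp only [sum_apply]
  exact continuous_finsetSum s fun i hi => h i hi k

theorem ContPath.mul {x y : ℝ → B.Series} (hx : ContPath x) (hy : ContPath y) :
    ContPath (fun t => x t * y t) := fun k => by
  simp only [mul_apply]
  exact continuous_finsetSum _ fun p _ =>
    ((B.mul p.1 p.2 k).continuous.comp (hx p.1)).clm_apply (hy p.2)

theorem ContPath.negAd_pow {a b : ℝ → B.Series} (ha : ContPath a) (hb : ContPath b) (m : ℕ) :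
    ContPath (fun t => (negAd (a t) ^ m) (b t)) := by
  induction m with
  | zero => simpa using hb
  | succ m ih =>
    simp only [pow_succ', Module.End.mul_apply, negAd_apply]
    exact (ih.mul ha).sub (ha.mul ih)

theorem ContPath.logDerivT {a b : ℝ → B.Series} (ha : ContPath a) (hb : ContPath b) (N : ℕ) :
    ContPath (fun t => logDerivT N (a t) (b t)) :=
  ContPath.sum fun m _ => (ha.negAd_pow hb m).smul _

end Series

/-! ### Lie series -/

/-- A family of closed subspaces, zero in degree `0`, closed under brackets. -/
structure IsLieFamily (B : GradedMul W) (L : ∀ k, Submodule ℝ (W k)) : Prop where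
  zero : L 0 = ⊥
  isClosed : ∀ k, IsClosed (L k : Set (W k))
  bracket : ∀ i j k, i + j = k → ∀ u ∈ L i, ∀ v ∈ L j, B.mul i j k u v - B.mul j i k v u ∈ L k

namespace Series

variable {L : ∀ k, Submodule ℝ (W k)}

/-- Series all of whose terms lie in the family `L`. -/
def lieSeries (B : GradedMul W) (L : ∀ k, Submodule ℝ (W k)) : Submodule ℝ B.Series where
  carrier := {x | ∀ k, x k ∈ L k}
  add_mem' hx hy k := (L k).add_mem (hx k) (hy k)
  zero_mem' k := (L k).zero_mem
  smul_mem' c _ hx k := (L k).smul_mem c (hx k)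

theorem orderGE_of_mem_lieSeries (hL : B.IsLieFamily L) {x : B.Series} (hx : x ∈ lieSeries B L) :
    OrderGE 1 x := fun k hk => by
  obtain rfl : k = 0 := by omega
  have := hx 0
  rwa [hL.zero, Submodule.mem_bot] at this

theorem negAd_mem_lieSeries (hL : B.IsLieFamily L) {x y : B.Series} (hx : x ∈ lieSeries B L)
    (hy : y ∈ lieSeries B L) : negAd x y ∈ lieSeries B L := fun k => by
  rw [negAd_apply, sub_apply, mul_apply, mul_apply, ← Finset.Nat.sum_antidiagonal_swap (n := k),
    ← Finset.sum_sub_distrib]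
  refine Submodule.sum_mem _ fun p hp => ?_
  rw [Finset.HasAntidiagonal.mem_antidiagonal] at hp
  exact hL.bracket p.2 p.1 k (by omega) _ (hy _) _ (hx _)

theorem logDerivT_mem_lieSeries (hL : B.IsLieFamily L) {x y : B.Series} (hx : x ∈ lieSeries B L)
    (hy : y ∈ lieSeries B L) (N : ℕ) : logDerivT N x y ∈ lieSeries B L := by
  refine Submodule.sum_mem _ fun m hm => Submodule.smul_mem _ _ ?_
  clear hm
  induction m with
  | zero => exact hy
  | succ m ih =>
    rw [pow_succ', Module.End.mul_apply]
    exact negAd_mem_lieSeries hL hx ih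

theorem _root_.Submodule.intervalIntegral_mem {E : Type*} [NormedAddCommGroup E] [NormedSpace ℝ E]
    [CompleteSpace E] {S : Submodule ℝ E} (hS : IsClosed (S : Set E)) {f : ℝ → E}
    (hf : Continuous f) (hfS : ∀ t, f t ∈ S) (a b : ℝ) : ∫ t in a..b, f t ∈ S := by
  have : CompleteSpace S := hS.completeSpace_coe
  let g : ℝ → S := fun t => ⟨f t, hfS t⟩
  have hg : Continuous g := hf.subtype_mk hfS
  have h := S.subtypeL.intervalIntegral_comp_comm (hg.intervalIntegrable (μ := MeasureTheory.volume) a b)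
  exact h ▸ (∫ t in a..b, g t).2

variable (B) in
/-- The series with a single term `w` in degree `n`. -/
def single (n : ℕ) (w : W n) : B.Series := Pi.single n w

theorem single_apply_self (n : ℕ) (w : W n) : single B n w n = w := Pi.single_eq_same n w

theorem single_apply_of_ne {n k : ℕ} (h : k ≠ n) (w : W n) : single B n w k = 0 :=
  Pi.single_eq_of_ne h w

theorem single_zero (n : ℕ) : single B n 0 = 0 := Pi.single_zero n

theorem single_orderGE (n : ℕ) (w : W n) : OrderGE n (single B n w) :=
  fun _ hk => single_apply_of_ne hk.ne w

theorem single_mem_lieSeries {n : ℕ} {w : W n} (hw : w ∈ L n) : single B n w ∈ lieSeries B L :=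
  fun k => by
    by_cases h : k = n
    · subst h; rwa [single_apply_self]
    · rw [single_apply_of_ne h]; exact zero_mem _

/-- Every continuous path of Lie series is, up to degree `n`, the logarithmic derivative of the
exponential of a `C¹` path of Lie series. -/
theorem exists_logDerivT_eq [∀ k, CompleteSpace (W k)] (hL : B.IsLieFamily L) {N : ℕ} (hN : 1 ≤ N)
    {g : ℝ → B.Series} (hg : ContPath g) (hgL : ∀ t, g t ∈ lieSeries B L) (n : ℕ) :
    ∃ a a' : ℝ → B.Series, a 0 = 0 ∧ HasDeriv a a' ∧ ContPath a' ∧ (∀ t, a t ∈ lieSeries B L) ∧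
      (∀ t, a' t ∈ lieSeries B L) ∧ ∀ t, ∀ k ≤ n, logDerivT N (a t) (a' t) k = g t k := by
  induction n with
  | zero =>
    refine ⟨fun _ => 0, fun _ => 0, rfl, fun k t => hasDerivAt_const t _, fun k => continuous_const,
      fun _ => zero_mem _, fun _ => zero_mem _, fun t k hk => ?_⟩
    rw [orderGE_of_mem_lieSeries hL (hgL t) k (by omega),
      orderGE_of_mem_lieSeries hL
        (logDerivT_mem_lieSeries hL (zero_mem _) (zero_mem _) N) k (by omega)]
  | succ n ih =>
    obtain ⟨a, a', ha0, hd, hc', hmem, hmem', heq⟩ := ih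
    set f : ℝ → W (n + 1) := fun t => g t (n + 1) - logDerivT N (a t) (a' t) (n + 1)
    have hfc : Continuous f := (hg _).sub (hd.contPath.logDerivT hc' N _)
    have hfL : ∀ t, f t ∈ L (n + 1) := fun t =>
      (L _).sub_mem (hgL t _) (logDerivT_mem_lieSeries hL (hmem t) (hmem' t) N _)
    refine ⟨fun t => a t + single B (n + 1) (∫ s in (0 : ℝ)..t, f s),
      fun t => a' t + single B (n + 1) (f t), ?_, hd.add fun k t => ?_, hc'.add fun k => ?_,
      fun t => add_mem (hmem t) (single_mem_lieSeries ?_),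
      fun t => add_mem (hmem' t) (single_mem_lieSeries (hfL t)), fun t k hk => ?_⟩
    · beta_reduce
      rw [ha0, intervalIntegral.integral_same, single_zero, add_zero]
    · by_cases h : k = n + 1
      · subst h
        simp only [single_apply_self]
        exact (hfc.integral_hasStrictDerivAt 0 t).hasDerivAt
      · simp only [single_apply_of_ne h]
        exact hasDerivAt_const t _
    · by_cases h : k = n + 1
      · subst h
        simpa only [single_apply_self] using hfc
      · simpa only [single_apply_of_ne h] using continuous_const
    · exact Submodule.intervalIntegral_mem (hL.isClosed _) hfc hfL 0 t
    · rw [logDerivT_add_apply hN (orderGE_of_mem_lieSeries hL (hmem t))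
        (orderGE_of_mem_lieSeries hL (hmem' t)) (single_orderGE _ _) (single_orderGE _ _) hk]
      by_cases h : k = n + 1
      · subst h
        rw [single_apply_self]
        exact add_sub_cancel _ _
      · rw [single_apply_of_ne h, add_zero, heq t k (by omega)]

theorem mul_apply_congr {k : ℕ} {x x' y y' : B.Series} (hy : OrderGE 1 y)
    (hx : ∀ j < k, x j = x' j) (hyy : ∀ j ≤ k, y j = y' j) : (x * y) k = (x' * y') k := by
  rw [mul_apply, mul_apply]
  refine Finset.sum_congr rfl fun p hp => ?_
  rw [Finset.HasAntidiagonal.mem_antidiagonal] at hp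
  rw [← hyy p.2 (by omega)]
  rcases Nat.eq_zero_or_pos p.2 with h | h
  · rw [hy p.2 (by omega), map_zero, map_zero]
  · rw [hx p.1 (by omega)]

theorem expSum_zero (N : ℕ) : expSum B N 0 = 1 := by
  rw [expSum, Finset.sum_range_succ', Finset.sum_eq_zero]
  · simp
  · intro j _
    simp

/-- The solution of `dy = y dγ` with `γ' = g` a continuous path of Lie series is the
exponential of a Lie series. -/
theorem exists_eq_expSum [∀ k, CompleteSpace (W k)] (hL : B.IsLieFamily L) {N : ℕ} (hN : 1 ≤ N)
    {g : ℝ → B.Series} (hg : ContPath g) (hgL : ∀ t, g t ∈ lieSeries B L) {y : ℝ → B.Series}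
    (hy : ∀ t ∈ Set.Icc (0 : ℝ) 1, ∀ k ≤ N,
      y t k = (1 : B.Series) k + ∫ s in (0 : ℝ)..t, (y s * g s) k) :
    ∃ a : ℝ → B.Series, (∀ t, a t ∈ lieSeries B L) ∧
      ∀ t ∈ Set.Icc (0 : ℝ) 1, ∀ k ≤ N, y t k = expSum B N (a t) k := by
  obtain ⟨a, a', ha0, hd, hc', hmem, hmem', heq⟩ := exists_logDerivT_eq hL hN hg hgL N
  refine ⟨a, hmem, fun t ht k => ?_⟩
  have hg1 : ∀ t, OrderGE 1 (g t) := fun t => orderGE_of_mem_lieSeries hL (hgL t)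
  have hE : ∀ k ≤ N, ∀ t, HasDerivAt (fun s => expSum B N (a s) k)
      ((expSum B N (a t) * g t) k) t := fun k hk t => by
    rw [mul_apply_congr (hg1 t) (fun _ _ => rfl) fun j hj => (heq t j (hj.trans hk)).symm]
    exact hd.expSum_apply (fun t => orderGE_of_mem_lieSeries hL (hmem t))
      (fun t => orderGE_of_mem_lieSeries hL (hmem' t)) hk t
  have hEc : ContPath fun t => expSum B N (a t) :=
    (HasDeriv.sum (s := Finset.range (N + 1)) fun j _ => (hd.pow j).smul _).contPath
  induction k using Nat.strong_induction_on generalizing t with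
  | _ k ih =>
    intro hk
    have h := intervalIntegral.integral_eq_sub_of_hasDerivAt (a := 0) (b := t)
      (fun s _ => hE k hk s) ((hEc.mul hg k).intervalIntegrable 0 t)
    rw [ha0, expSum_zero] at h
    rw [hy t ht k hk, eq_add_of_sub_eq' h.symm]
    congr 1
    refine intervalIntegral.integral_congr fun s hs => ?_
    rw [Set.uIcc_of_le ht.1] at hs
    exact mul_apply_congr (hg1 s)
      (fun j hj => ih j hj s ⟨hs.1, hs.2.trans ht.2⟩ (hj.le.trans hk)) fun _ _ => rfl

end Series

end GradedMul

/-! ### Comparison with `truncMul`, `expT` and `LieLevel` -/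

@[simp] theorem castW_rfl {V : ℕ → Type*} [∀ k, NormedAddCommGroup (V k)] {i : ℕ} (x : V i) :
    castW (rfl : i = i) x = x := rfl

theorem castW_castW {V : ℕ → Type*} [∀ k, NormedAddCommGroup (V k)] {i j k : ℕ}
    (h : i = j) (h' : j = k) (x : V i) :
    castW h' (castW h x) = castW (h.trans h') x := by
  subst h; subst h'; rfl

theorem castW_sub {V : ℕ → Type*} [∀ k, NormedAddCommGroup (V k)] {i j : ℕ}
    (h : i = j) (x y : V i) :
    castW h (x - y) = castW h x - castW h y := by
  subst h; rfl

/-- The bounded bilinear map `μ i j`, with values transported to degree `k` when `i + j = k`. -/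
def transportMul (μ : ∀ i j, W i →ₗ[ℝ] W j →ₗ[ℝ] W (i + j))
    (hnorm : ∀ (i j : ℕ) (x : W i) (y : W j), ‖μ i j x y‖ ≤ ‖x‖ * ‖y‖) (i j k : ℕ) :
    W i →L[ℝ] W j →L[ℝ] W k :=
  if h : i + j = k then
    h ▸ LinearMap.mkContinuous₂ (μ i j) 1 (fun x y => by simpa using hnorm i j x y)
  else 0

theorem transportMul_apply {μ : ∀ i j, W i →ₗ[ℝ] W j →ₗ[ℝ] W (i + j)}
    {hnorm : ∀ (i j : ℕ) (x : W i) (y : W j), ‖μ i j x y‖ ≤ ‖x‖ * ‖y‖} {i j k : ℕ}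
    (h : i + j = k) (x : W i) (y : W j) :
    transportMul μ hnorm i j k x y = castW h (μ i j x y) := by
  subst h
  simp [transportMul]

/-- The graded multiplication attached to the bilinear maps `μ` with unit `e`. -/
def GradedMul.ofBilin (μ : ∀ i j, W i →ₗ[ℝ] W j →ₗ[ℝ] W (i + j)) (e : W 0)
    (hnorm : ∀ (i j : ℕ) (x : W i) (y : W j), ‖μ i j x y‖ ≤ ‖x‖ * ‖y‖)
    (hleft : ∀ (j : ℕ) (x : W j), castW (Nat.zero_add j) (μ 0 j e x) = x)
    (hright : ∀ (j : ℕ) (x : W j), μ j 0 x e = x)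
    (hassoc : ∀ (i j k : ℕ) (x : W i) (y : W j) (z : W k),
      castW (Nat.add_assoc i j k) (μ (i + j) k ((μ i j x) y) z) = μ i (j + k) x (μ j k y z)) :
    GradedMul W where
  mul := transportMul μ hnorm
  one := e
  one_mul j x := (transportMul_apply (Nat.zero_add j) e x).trans (hleft j x)
  mul_one j x := (transportMul_apply (Nat.add_zero j) x e).trans (hright j x)
  mul_assoc i j k l s t hs hl ht x y z := by
    subst hs hl ht
    rw [transportMul_apply rfl, transportMul_apply rfl, transportMul_apply rfl,
      transportMul_apply (Nat.add_assoc i j k).symm]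
    simp only [castW_rfl]
    rw [← hassoc, castW_castW, castW_rfl]

theorem LieLevel_isClosed (μ : ∀ i j, W i →ₗ[ℝ] W j →ₗ[ℝ] W (i + j)) (k : ℕ) :
    IsClosed (LieLevel μ k : Set (W k)) := by
  match k with
  | 0 => simp [LieLevel]
  | 1 => simp [LieLevel]
  | k + 2 =>
    rw [LieLevel]
    exact Submodule.isClosed_topologicalClosure _

section Comparison

variable {μ : ∀ i j, W i →ₗ[ℝ] W j →ₗ[ℝ] W (i + j)} {B : GradedMul W}

theorem castW_bra (hB : ∀ i j k (h : i + j = k) (x : W i) (y : W j),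
    B.mul i j k x y = castW h (μ i j x y)) {i j k : ℕ} (h : i + j = k) (x : W i) (y : W j) :
    castW h (bra μ x y) = B.mul i j k x y - B.mul j i k y x := by
  rw [hB i j k h, hB j i k (by omega), bra, castW_sub, castW_castW]

theorem bracket_deg_one_mem (hB : ∀ i j k (h : i + j = k) (x : W i) (y : W j),
    B.mul i j k x y = castW h (μ i j x y)) {j k : ℕ} (h : 1 + j = k) (v : W 1) {w : W j}
    (hw : w ∈ LieLevel μ j) : B.mul 1 j k v w - B.mul j 1 k w v ∈ LieLevel μ k := by
  cases j with
  | zero =>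
    rw [LieLevel, Submodule.mem_bot] at hw
    simp [hw]
  | succ j =>
    obtain rfl : k = j + 2 := by omega
    rw [LieLevel, ← castW_bra hB h]
    exact Submodule.le_topologicalClosure _ (Submodule.subset_span ⟨v, w, hw, rfl⟩)

theorem bracket_mem (hB : ∀ i j k (h : i + j = k) (x : W i) (y : W j),
    B.mul i j k x y = castW h (μ i j x y)) (i : ℕ) : ∀ j k, i + 1 + j = k →
    ∀ u ∈ LieLevel μ (i + 1), ∀ z ∈ LieLevel μ j,
      B.mul (i + 1) j k u z - B.mul j (i + 1) k z u ∈ LieLevel μ k := by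
  induction i with
  | zero => exact fun j k h u _ z hz => bracket_deg_one_mem hB (by omega) u hz
  | succ i ih =>
    intro j k h u hu z hz
    let T : W (i + 2) →L[ℝ] W k := (B.mul (i + 2) j k).flip z - B.mul j (i + 2) k z
    suffices hT : LieLevel μ (i + 2) ≤ (LieLevel μ k).comap T.toLinearMap from hT hu
    rw [LieLevel]
    refine Submodule.topologicalClosure_minimal _ (Submodule.span_le.2 ?_)
      ((LieLevel_isClosed μ k).preimage T.continuous)
    rintro _ ⟨v, w, hw, rfl⟩
    have h1 := bracket_deg_one_mem hB (k := k) (by omega) v (ih j _ rfl w hw z hz)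
    have h2 := ih (1 + j) k (by omega) w hw _ (bracket_deg_one_mem hB rfl v hz)
    have key : T (castW (Nat.add_comm 1 (i + 1)) (bra μ v w)) ∈ LieLevel μ k := by
      convert sub_mem h1 h2 using 1
      rw [castW_bra hB]
      have e1 := B.mul_assoc 1 (i + 1) j (i + 1 + j) (i + 2) k (by omega) rfl (by omega) v w z
      have e2 := B.mul_assoc (i + 1) 1 j (1 + j) (i + 2) k (by omega) rfl (by omega) w v z
      have e3 := B.mul_assoc (i + 1) j 1 (1 + j) (i + 1 + j) k (by omega) (by omega) (by omega) w z v
      have e4 := B.mul_assoc j (i + 1) 1 (i + 2) (i + 1 + j) k (by omega) (by omega) (by omega) z w v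
      have e5 := B.mul_assoc 1 j (i + 1) (i + 1 + j) (1 + j) k (by omega) (by omega) (by omega) v z w
      have e6 := B.mul_assoc j 1 (i + 1) (i + 2) (1 + j) k (by omega) (by omega) (by omega) z v w
      simp only [T, _root_.sub_apply, ContinuousLinearMap.flip_apply, map_sub, e1, e2, e3, e4, e5,
        e6]
      abel
    exact key

theorem isLieFamily_LieLevel (hB : ∀ i j k (h : i + j = k) (x : W i) (y : W j),
    B.mul i j k x y = castW h (μ i j x y)) : B.IsLieFamily (LieLevel μ) where
  zero := by rw [LieLevel]
  isClosed := LieLevel_isClosed μ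
  bracket i j k h u hu v hv := by
    cases i with
    | zero =>
      rw [LieLevel, Submodule.mem_bot] at hu
      simp [hu]
    | succ i => exact bracket_mem hB i j k h u hu v hv

theorem truncMul_eq_mul (hB : ∀ i j k (h : i + j = k) (x : W i) (y : W j),
    B.mul i j k x y = castW h (μ i j x y)) (x y : B.Series) : truncMul μ x y = x * y := by
  funext k
  rw [GradedMul.Series.mul_apply, Finset.Nat.sum_antidiagonal_eq_sum_range_succ_mk,
    Finset.sum_range]
  exact Finset.sum_congr rfl fun j _ => (hB _ _ _ _ _ _).symm

theorem tpow_eq_pow (hB : ∀ i j k (h : i + j = k) (x : W i) (y : W j),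
    B.mul i j k x y = castW h (μ i j x y)) (x : B.Series) (n : ℕ) :
    tpow μ B.one x n = x ^ n := by
  induction n with
  | zero => rw [pow_zero]; rfl
  | succ n ih =>
    change truncMul μ x (tpow μ B.one x n) = x ^ (n + 1)
    rw [ih, pow_succ', truncMul_eq_mul hB]

theorem expT_eq_expSum (hB : ∀ i j k (h : i + j = k) (x : W i) (y : W j),
    B.mul i j k x y = castW h (μ i j x y)) (N : ℕ) (a : B.Series) :
    expT μ B.one N a = GradedMul.Series.expSum B N a := by
  have h : expT μ B.one N a =
      (1 : B.Series) + ∑ j ∈ Finset.Icc 1 N, ((j.factorial : ℝ))⁻¹ • a ^ j := by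
    simp only [← tpow_eq_pow hB]
    rfl
  rw [h, GradedMul.Series.expSum, Finset.range_eq_Ico, Finset.sum_eq_sum_Ico_succ_bot (by omega)]
  simp
  rfl

end Comparison

theorem HasDerivWithinAt.mem_submodule {E : Type*} [NormedAddCommGroup E] [NormedSpace ℝ E]
    {S : Submodule ℝ E} (hS : IsClosed (S : Set E)) {f : ℝ → E} {f' : E} {s : Set ℝ} {t : ℝ}
    (h : HasDerivWithinAt f f' s t) (hu : UniqueDiffWithinAt ℝ s t) (ht : t ∈ s)
    (hf : ∀ x ∈ s, f x ∈ S) : f' ∈ S := by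
  have := uniqueDiffWithinAt_iff_accPt.1 hu
  have : (nhdsWithin t (s \ {t})).NeBot := by
    rwa [accPt_principal_iff_nhdsWithin] at this
  refine hS.mem_of_tendsto (hasDerivWithinAt_iff_tendsto_slope.1 h) ?_
  filter_upwards [self_mem_nhdsWithin] with x hx
  exact S.smul_mem _ (S.sub_mem (hf x hx.1) (hf t ht))

/-- The solution of `dy = y ⊗ dγ` driven by a differentiable
Lie-algebra-valued path stays in the free nilpotent group
`G^{[p]}(U) = {exp a : a Lie polynomial of degree ≤ [p]}`. -/
theorem log_ode_solution_group_valued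
    [∀ k, CompleteSpace (W k)]
    (N : ℕ) (hN : 1 ≤ N)
    (μ : ∀ i j, W i →ₗ[ℝ] W j →ₗ[ℝ] W (i + j)) (e : W 0)
    (hnorm : ∀ (i j : ℕ) (x : W i) (y : W j), ‖μ i j x y‖ ≤ ‖x‖ * ‖y‖)
    (hleft : ∀ (j : ℕ) (x : W j), castW (Nat.zero_add j) (μ 0 j e x) = x)
    (hright : ∀ (j : ℕ) (x : W j), μ j 0 x e = x)
    (hassoc : ∀ (i j k : ℕ) (x : W i) (y : W j) (z : W k),
      castW (Nat.add_assoc i j k) (μ (i + j) k ((μ i j x) y) z) = μ i (j + k) x (μ j k y z))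
    (γ γ' : ℝ → ∀ k, W k)
    (hγ0 : ∀ k, γ 0 k = 0)
    (hLie : ∀ t ∈ Set.Icc (0 : ℝ) 1, ∀ k ≤ N, γ t k ∈ LieLevel μ k)
    (hderiv : ∀ (k : ℕ), ∀ t ∈ Set.Icc (0 : ℝ) 1,
      HasDerivAt (fun u => γ u k) (γ' t k) t)
    (hcont : ∀ k, ContinuousOn (fun u => γ' u k) (Set.Icc 0 1))
    (y : ℝ → ∀ k, W k)
    (hODE : ∀ t ∈ Set.Icc (0 : ℝ) 1, ∀ k ≤ N,
      y t k = unitT e k + ∫ u in (0 : ℝ)..t, truncMul μ (y u) (γ' u) k) :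
    ∀ t ∈ Set.Icc (0 : ℝ) 1,
      ∃ a : ∀ k, W k, (∀ k ≤ N, a k ∈ LieLevel μ k) ∧
        ∀ k ≤ N, y t k = expT μ e N a k := by
  let B := GradedMul.ofBilin μ e hnorm hleft hright hassoc
  have hB : ∀ i j k (h : i + j = k) (x : W i) (y : W j),
      B.mul i j k x y = castW h (μ i j x y) :=
    fun _ _ _ h x y => transportMul_apply (hnorm := hnorm) h x y
  have hγ'L : ∀ t ∈ Set.Icc (0 : ℝ) 1, ∀ k ≤ N, γ' t k ∈ LieLevel μ k := fun t ht k hk =>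
    (hderiv k t ht).hasDerivWithinAt.mem_submodule (LieLevel_isClosed μ k)
      (uniqueDiffOn_Icc zero_lt_one t ht) ht fun u hu => hLie u hu k hk
  let g : ℝ → B.Series := fun t k => if k ≤ N then γ' (Set.projIcc 0 1 zero_le_one t) k else 0
  have hgc : GradedMul.Series.ContPath g := fun k => by
    by_cases hk : k ≤ N
    · simpa only [g, if_pos hk] using! (hcont k).comp_continuous
        (continuous_subtype_val.comp continuous_projIcc) fun t => Subtype.coe_prop _
    · simpa only [g, if_neg hk] using continuous_const
  have hgL : ∀ t, g t ∈ GradedMul.Series.lieSeries B (LieLevel μ) := fun t k => by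
    by_cases hk : k ≤ N
    · simpa only [g, if_pos hk] using hγ'L _ (Subtype.coe_prop _) k hk
    · simpa only [g, if_neg hk] using zero_mem _
  have hL := isLieFamily_LieLevel hB
  obtain ⟨a, haL, ha⟩ := GradedMul.Series.exists_eq_expSum hL hN hgc hgL (y := y)
    fun t ht k hk => by
      rw [hODE t ht k hk]
      congr 1
      refine intervalIntegral.integral_congr fun s hs => ?_
      rw [Set.uIcc_of_le ht.1] at hs
      have hs' : s ∈ Set.Icc (0 : ℝ) 1 := ⟨hs.1, hs.2.trans ht.2⟩
      refine (congrFun (truncMul_eq_mul hB (y s) (γ' s)) k).trans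
        (GradedMul.Series.mul_apply_congr (GradedMul.Series.orderGE_of_mem_lieSeries hL (hgL s))
        (fun _ _ => rfl) fun j hj => ?_).symm
      simp only [g, if_pos (hj.trans hk), Set.projIcc_of_mem zero_le_one hs']
  refine fun t ht => ⟨a t, fun k _ => haL t k, fun k hk => ?_⟩
  rw [ha t ht k hk, ← expT_eq_expSum hB]
  rfl

end
end
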